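/- Let λ, μ, α, λ', μ', α' ∈ k and let z1, z2, β1, β2 ∈ k satisfy z1β2 − z2β1 ≠ 0 together with z1^2 λ' + 2 z1 z2 α' + z2^2 μ' = λ, β1^2 λ' + 2 β1 β2 α' + β2^2 μ' = μ, and z1 β1 λ' + z2 β2 μ' + (z1 β2 + z2 β1) α' = α. Then there is a k-algebra isomorphism Φ : U_14(λ,μ,α) → U_14(λ',μ',α') determined by Φ(a) = a, Φ(b) = b, Φ(c) = c, Φ(d) = d, Φ(p1) = z1 p1 + z2 q1, Φ(p2) = z1 p2 + z2 q2, Φ(q1) = β1 p1 + β2 q1, Φ(q2) = β1 p2 + β2 q2. -/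

import Mathlib

namespace Stmt19

/-- The generators `a, b, c, d, p1, p2, q1, q2`. -/
inductive Gen | a | b | c | d | p1 | p2 | q1 | q2

open Gen

variable (k : Type*) [Field k]

/-- The generators viewed inside the free algebra. -/
abbrev g (x : Gen) : FreeAlgebra k Gen := FreeAlgebra.ι k x

variable (lam mu alp : k)

/-- The defining relations of `U_14(λ,μ,α)`. -/
inductive Rel : FreeAlgebra k Gen → FreeAlgebra k Gen → Prop
  -- H-relations
  | haa : Rel (g k a * g k a) 1
  | hbb : Rel (g k b * g k b) 1
  | hcc : Rel (g k c * g k c) 1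
  | hab : Rel (g k a * g k b) (g k b * g k a)
  | hac : Rel (g k a * g k c) (g k c * g k a)
  | hbc : Rel (g k b * g k c) (g k c * g k b)
  | hdd : Rel (g k d * g k d) (g k a)
  | hda : Rel (g k d * g k a) (g k a * g k d)
  | hdb : Rel (g k d * g k b) (g k c * g k d)
  | hdc : Rel (g k d * g k c) (g k b * g k d)
  -- relations between a,b,c,d and p1,p2
  | ap1 : Rel (g k a * g k p1) (g k p1 * g k a)
  | bp1 : Rel (g k b * g k p1) (-(g k p1 * g k b))
  | cp1 : Rel (g k c * g k p1) (-(g k p1 * g k c))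
  | dp1 : Rel (g k d * g k p1) (g k p2 * g k d)
  | ap2 : Rel (g k a * g k p2) (g k p2 * g k a)
  | bp2 : Rel (g k b * g k p2) (-(g k p2 * g k b))
  | cp2 : Rel (g k c * g k p2) (-(g k p2 * g k c))
  | dp2 : Rel (g k d * g k p2) (g k p1 * g k d)
  | p1p1 : Rel (g k p1 * g k p1) 0
  | p2p2 : Rel (g k p2 * g k p2) 0
  | p1p2 : Rel (g k p1 * g k p2 + g k p2 * g k p1) (lam • (1 - g k b * g k c))
  -- relations between a,b,c,d and q1,q2
  | aq1 : Rel (g k a * g k q1) (g k q1 * g k a)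
  | bq1 : Rel (g k b * g k q1) (-(g k q1 * g k b))
  | cq1 : Rel (g k c * g k q1) (-(g k q1 * g k c))
  | dq1 : Rel (g k d * g k q1) (g k q2 * g k d)
  | aq2 : Rel (g k a * g k q2) (g k q2 * g k a)
  | bq2 : Rel (g k b * g k q2) (-(g k q2 * g k b))
  | cq2 : Rel (g k c * g k q2) (-(g k q2 * g k c))
  | dq2 : Rel (g k d * g k q2) (g k q1 * g k d)
  | q1q1 : Rel (g k q1 * g k q1) 0
  | q2q2 : Rel (g k q2 * g k q2) 0
  | q1q2 : Rel (g k q1 * g k q2 + g k q2 * g k q1) (mu • (1 - g k b * g k c))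
  -- relations between p's and q's
  | p1q1 : Rel (g k p1 * g k q1 + g k q1 * g k p1) 0
  | p2q2 : Rel (g k p2 * g k q2 + g k q2 * g k p2) 0
  | p1q2 : Rel (g k p1 * g k q2 + g k q2 * g k p1) (alp • (1 - g k b * g k c))
  | p2q1 : Rel (g k p2 * g k q1 + g k q1 * g k p2) (alp • (1 - g k b * g k c))

/-- The algebra `U_14(λ,μ,α)`. -/
abbrev U := RingQuot (Rel k lam mu alp)

/-- The quotient map. -/
noncomputable abbrev mk : FreeAlgebra k Gen →ₐ[k] U k lam mu alp :=
  RingQuot.mkAlgHom k (Rel k lam mu alp)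

section LinearChange

variable {k lam mu alp} {A : Type*} [Ring A] [Algebra k A]

theorem mul_smul_add_smul {x p q p' q' : A} (hp : x * p = p' * x) (hq : x * q = q' * x)
    (z w : k) : x * (z • p + w • q) = (z • p' + w • q') * x := by
  simp only [mul_add, add_mul, mul_smul_comm, smul_mul_assoc, hp, hq]

theorem mul_smul_add_smul_neg {x p q : A} (hp : x * p = -(p * x)) (hq : x * q = -(q * x))
    (z w : k) : x * (z • p + w • q) = -((z • p + w • q) * x) := by
  simp only [mul_add, add_mul, mul_smul_comm, smul_mul_assoc, hp, hq]
  module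

theorem smul_add_smul_mul_self {p q : A} (hp : p * p = 0) (hq : q * q = 0)
    (hpq : p * q + q * p = 0) (z w : k) : (z • p + w • q) * (z • p + w • q) = 0 := by
  have h : (z • p + w • q) * (z • p + w • q)
      = (z * z) • (p * p) + (z * w) • (p * q + q * p) + (w * w) • (q * q) := by
    simp only [mul_add, add_mul, mul_smul_comm, smul_mul_assoc]
    module
  rw [h, hp, hq, hpq]
  simp

/-- The anticommutator of linear combinations, expanded bilinearly when all anticommutators are
multiples of one element. -/
theorem anticommutator_smul_add_smul {p q p' q' e : A} {s t u v r : k}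
    (hpp : p * p' + p' * p = s • e) (hpq : p * q' + q' * p = t • e)
    (hqp : q * p' + p' * q = u • e) (hqq : q * q' + q' * q = v • e) (z w z' w' : k)
    (hr : z * z' * s + z * w' * t + w * z' * u + w * w' * v = r) :
    (z • p + w • q) * (z' • p' + w' • q') + (z' • p' + w' • q') * (z • p + w • q) = r • e := by
  have h : (z • p + w • q) * (z' • p' + w' • q') + (z' • p' + w' • q') * (z • p + w • q)
      = (z * z') • (p * p' + p' * p) + (z * w') • (p * q' + q' * p)
        + (w * z') • (q * p' + p' * q) + (w * w') • (q * q' + q' * q) := by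
    simp only [mul_add, add_mul, mul_smul_comm, smul_mul_assoc]
    module
  rw [h, hpp, hpq, hqp, hqq, ← hr]
  module

/-- The images of the generators under `f`, after a linear change of `p1, q1` and `p2, q2`. -/
def linearChange (f : FreeAlgebra k Gen →ₐ[k] A) (z1 z2 b1 b2 : k) : Gen → A
  | p1 => z1 • f (g k p1) + z2 • f (g k q1)
  | p2 => z1 • f (g k p2) + z2 • f (g k q2)
  | q1 => b1 • f (g k p1) + b2 • f (g k q1)
  | q2 => b1 • f (g k p2) + b2 • f (g k q2)
  | x => f (g k x)

theorem lift_linearChange_eq_of_rel {lam' mu' alp' z1 z2 b1 b2 : k}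
    (h1 : z1 ^ 2 * lam' + 2 * z1 * z2 * alp' + z2 ^ 2 * mu' = lam)
    (h2 : b1 ^ 2 * lam' + 2 * b1 * b2 * alp' + b2 ^ 2 * mu' = mu)
    (h3 : z1 * b1 * lam' + z2 * b2 * mu' + (z1 * b2 + z2 * b1) * alp' = alp)
    {f : FreeAlgebra k Gen →ₐ[k] A} (hf : ∀ {x y}, Rel k lam' mu' alp' x y → f x = f y)
    {x y : FreeAlgebra k Gen} (h : Rel k lam mu alp x y) :
    FreeAlgebra.lift k (linearChange f z1 z2 b1 b2) x
      = FreeAlgebra.lift k (linearChange f z1 z2 b1 b2) y := by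
  have hpp := hf .p1p2
  have hqq := hf .q1q2
  have hpq := hf .p1q2
  have hqp := hf .p2q1
  have hpq1 := hf .p1q1
  have hpq2 := hf .p2q2
  simp only [map_add, map_mul, map_smul, map_sub, map_one, map_zero] at hpp hqq hpq hqp hpq1 hpq2
  have hp1 : f (g k p1) * f (g k p1) = 0 := by simpa only [map_mul, map_zero] using hf .p1p1
  have hp2 : f (g k p2) * f (g k p2) = 0 := by simpa only [map_mul, map_zero] using hf .p2p2
  have hq1 : f (g k q1) * f (g k q1) = 0 := by simpa only [map_mul, map_zero] using hf .q1q1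
  have hq2 : f (g k q2) * f (g k q2) = 0 := by simpa only [map_mul, map_zero] using hf .q2q2
  have hqp' := (add_comm _ _).trans hqp
  have hcross {p q : A} (hp : p * p = 0) (hq : q * q = 0) (hpq : p * q + q * p = 0) :
      (z1 • p + z2 • q) * (b1 • p + b2 • q) + (b1 • p + b2 • q) * (z1 • p + z2 • q) = 0 := by
    have := anticommutator_smul_add_smul (k := k) (e := (0 : A)) (s := 0) (t := 0) (u := 0)
      (v := 0) (r := 0) (p := p) (q := q) (p' := p) (q' := q) (by simp [hp])
      (by simpa using hpq) (by simpa using (add_comm _ _).trans hpq) (by simp [hq])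
      z1 z2 b1 b2 (by simp)
    simpa using this
  cases h <;> simp only [map_add, map_mul, map_smul, map_sub, map_neg, map_one, map_zero,
    FreeAlgebra.lift_ι_apply, linearChange]
  case haa => simpa only [map_mul, map_one] using hf .haa
  case hbb => simpa only [map_mul, map_one] using hf .hbb
  case hcc => simpa only [map_mul, map_one] using hf .hcc
  case hab => simpa only [map_mul] using hf .hab
  case hac => simpa only [map_mul] using hf .hac
  case hbc => simpa only [map_mul] using hf .hbc
  case hdd => simpa only [map_mul] using hf .hdd
  case hda => simpa only [map_mul] using hf .hda
  case hdb => simpa only [map_mul] using hf .hdb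
  case hdc => simpa only [map_mul] using hf .hdc
  case ap1 | dp1 | ap2 | dp2 | aq1 | dq1 | aq2 | dq2 =>
    apply mul_smul_add_smul <;> rw [← map_mul, ← map_mul] <;> apply hf <;> constructor
  case bp1 | cp1 | bp2 | cp2 | bq1 | cq1 | bq2 | cq2 =>
    apply mul_smul_add_smul_neg <;> rw [← map_mul, ← map_mul, ← map_neg] <;> apply hf <;>
      constructor
  case p1p1 | q1q1 => exact smul_add_smul_mul_self hp1 hq1 hpq1 _ _
  case p2p2 | q2q2 => exact smul_add_smul_mul_self hp2 hq2 hpq2 _ _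
  case p1p2 =>
    exact anticommutator_smul_add_smul hpp hpq hqp' hqq _ _ _ _ (by linear_combination h1)
  case q1q2 =>
    exact anticommutator_smul_add_smul hpp hpq hqp' hqq _ _ _ _ (by linear_combination h2)
  case p1q2 =>
    exact anticommutator_smul_add_smul hpp hpq hqp' hqq _ _ _ _ (by linear_combination h3)
  case p2q1 =>
    rw [add_comm]
    exact anticommutator_smul_add_smul hpp hpq hqp' hqq _ _ _ _ (by linear_combination h3)
  case p1q1 => exact hcross hp1 hq1 hpq1
  case p2q2 => exact hcross hp2 hq2 hpq2

end LinearChange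

section Hom

variable {k lam mu alp}

/-- The homomorphism `U_14(λ,μ,α) → U_14(λ',μ',α')` given by a linear change of generators
that is compatible with the parameters. -/
noncomputable def changeHom {lam' mu' alp' : k} (z1 z2 b1 b2 : k)
    (h1 : z1 ^ 2 * lam' + 2 * z1 * z2 * alp' + z2 ^ 2 * mu' = lam)
    (h2 : b1 ^ 2 * lam' + 2 * b1 * b2 * alp' + b2 ^ 2 * mu' = mu)
    (h3 : z1 * b1 * lam' + z2 * b2 * mu' + (z1 * b2 + z2 * b1) * alp' = alp) :
    U k lam mu alp →ₐ[k] U k lam' mu' alp' :=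
  RingQuot.liftAlgHom k
    ⟨FreeAlgebra.lift k (linearChange (mk k lam' mu' alp') z1 z2 b1 b2), fun _ _ h =>
      lift_linearChange_eq_of_rel h1 h2 h3 (fun h => RingQuot.mkAlgHom_rel k h) h⟩

theorem changeHom_mk {lam' mu' alp' z1 z2 b1 b2 : k}
    (h1 : z1 ^ 2 * lam' + 2 * z1 * z2 * alp' + z2 ^ 2 * mu' = lam)
    (h2 : b1 ^ 2 * lam' + 2 * b1 * b2 * alp' + b2 ^ 2 * mu' = mu)
    (h3 : z1 * b1 * lam' + z2 * b2 * mu' + (z1 * b2 + z2 * b1) * alp' = alp) (x : Gen) :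
    changeHom z1 z2 b1 b2 h1 h2 h3 (mk k lam mu alp (g k x))
      = linearChange (mk k lam' mu' alp') z1 z2 b1 b2 x := by
  simp [changeHom]

theorem smul_add_smul_smul_add_smul {A : Type*} [AddCommGroup A] [Module k A] {p q : A}
    {z w x y x' y' s t : k} (hs : z * x + w * x' = s) (ht : z * y + w * y' = t) :
    z • (x • p + y • q) + w • (x' • p + y' • q) = s • p + t • q := by
  rw [← hs, ← ht]
  module

/-- Changes of generators given by mutually inverse matrices compose to the identity. -/
theorem changeHom_comp_changeHom {lam' mu' alp' z1 z2 b1 b2 y1 y2 c1 c2 : k}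
    (h1 : z1 ^ 2 * lam' + 2 * z1 * z2 * alp' + z2 ^ 2 * mu' = lam)
    (h2 : b1 ^ 2 * lam' + 2 * b1 * b2 * alp' + b2 ^ 2 * mu' = mu)
    (h3 : z1 * b1 * lam' + z2 * b2 * mu' + (z1 * b2 + z2 * b1) * alp' = alp)
    (h1' : y1 ^ 2 * lam + 2 * y1 * y2 * alp + y2 ^ 2 * mu = lam')
    (h2' : c1 ^ 2 * lam + 2 * c1 * c2 * alp + c2 ^ 2 * mu = mu')
    (h3' : y1 * c1 * lam + y2 * c2 * mu + (y1 * c2 + y2 * c1) * alp = alp')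
    (e11 : z1 * y1 + z2 * c1 = 1) (e12 : z1 * y2 + z2 * c2 = 0)
    (e21 : b1 * y1 + b2 * c1 = 0) (e22 : b1 * y2 + b2 * c2 = 1) :
    (changeHom y1 y2 c1 c2 h1' h2' h3').comp (changeHom z1 z2 b1 b2 h1 h2 h3)
      = AlgHom.id k (U k lam mu alp) := by
  apply RingQuot.ringQuot_ext'
  apply FreeAlgebra.hom_ext
  funext x
  change changeHom y1 y2 c1 c2 h1' h2' h3' (changeHom z1 z2 b1 b2 h1 h2 h3
    (mk k lam mu alp (g k x))) = mk k lam mu alp (g k x)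
  rw [changeHom_mk]
  cases x <;> simp only [linearChange, map_add, map_smul, changeHom_mk]
  case p1 | p2 =>
    exact (smul_add_smul_smul_add_smul e11 e12).trans
      (by rw [one_smul, zero_smul, add_zero]; rfl)
  case q1 | q2 =>
    exact (smul_add_smul_smul_add_smul e21 e22).trans
      (by rw [zero_smul, one_smul, zero_add]; rfl)

end Hom

/-- Given parameters related by the stated quadratic equations with `z1·β2 − z2·β1 ≠ 0`,
`U_14(λ,μ,α) ≅ U_14(λ',μ',α')` via `a ↦ a`, `b ↦ b`, `c ↦ c`, `d ↦ d`,
`p1 ↦ z1 p1 + z2 q1`, `p2 ↦ z1 p2 + z2 q2`, `q1 ↦ β1 p1 + β2 q1`, `q2 ↦ β1 p2 + β2 q2`. -/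
theorem thm [IsAlgClosed k] [CharZero k] (lam mu alp lam' mu' alp' z1 z2 b1 b2 : k)
    (hdet : z1 * b2 - z2 * b1 ≠ 0)
    (h1 : z1 ^ 2 * lam' + 2 * z1 * z2 * alp' + z2 ^ 2 * mu' = lam)
    (h2 : b1 ^ 2 * lam' + 2 * b1 * b2 * alp' + b2 ^ 2 * mu' = mu)
    (h3 : z1 * b1 * lam' + z2 * b2 * mu' + (z1 * b2 + z2 * b1) * alp' = alp) :
    ∃ Φ : U k lam mu alp ≃ₐ[k] U k lam' mu' alp',
      Φ (mk k lam mu alp (g k a)) = mk k lam' mu' alp' (g k a) ∧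
      Φ (mk k lam mu alp (g k b)) = mk k lam' mu' alp' (g k b) ∧
      Φ (mk k lam mu alp (g k c)) = mk k lam' mu' alp' (g k c) ∧
      Φ (mk k lam mu alp (g k d)) = mk k lam' mu' alp' (g k d) ∧
      Φ (mk k lam mu alp (g k p1))
        = z1 • mk k lam' mu' alp' (g k p1) + z2 • mk k lam' mu' alp' (g k q1) ∧
      Φ (mk k lam mu alp (g k p2))
        = z1 • mk k lam' mu' alp' (g k p2) + z2 • mk k lam' mu' alp' (g k q2) ∧
      Φ (mk k lam mu alp (g k q1))
        = b1 • mk k lam' mu' alp' (g k p1) + b2 • mk k lam' mu' alp' (g k q1) ∧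
      Φ (mk k lam mu alp (g k q2))
        = b1 • mk k lam' mu' alp' (g k p2) + b2 • mk k lam' mu' alp' (g k q2) := by
  set D := z1 * b2 - z2 * b1 with hD
  have h1' : (b2 / D) ^ 2 * lam + 2 * (b2 / D) * (-z2 / D) * alp + (-z2 / D) ^ 2 * mu = lam' := by
    rw [← h1, ← h2, ← h3]
    field_simp
    rw [hD]
    ring
  have h2' : (-b1 / D) ^ 2 * lam + 2 * (-b1 / D) * (z1 / D) * alp + (z1 / D) ^ 2 * mu = mu' := by
    rw [← h1, ← h2, ← h3]
    field_simp
    rw [hD]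
    ring
  have h3' : (b2 / D) * (-b1 / D) * lam + (-z2 / D) * (z1 / D) * mu
      + ((b2 / D) * (z1 / D) + (-z2 / D) * (-b1 / D)) * alp = alp' := by
    rw [← h1, ← h2, ← h3]
    field_simp
    rw [hD]
    ring
  refine ⟨AlgEquiv.ofAlgHom (changeHom z1 z2 b1 b2 h1 h2 h3) (changeHom _ _ _ _ h1' h2' h3')
    (changeHom_comp_changeHom _ _ _ _ _ _ ?_ ?_ ?_ ?_)
    (changeHom_comp_changeHom _ _ _ _ _ _ ?_ ?_ ?_ ?_),
    changeHom_mk h1 h2 h3 a, changeHom_mk h1 h2 h3 b, changeHom_mk h1 h2 h3 c,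
    changeHom_mk h1 h2 h3 d, changeHom_mk h1 h2 h3 p1, changeHom_mk h1 h2 h3 p2,
    changeHom_mk h1 h2 h3 q1, changeHom_mk h1 h2 h3 q2⟩
  all_goals
    field_simp
    try rw [hD]
    try ring

end Stmt19
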